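/- Let A = diag(λ₁,…,λ_n) be a diagonal n×n complex matrix with |λ₁| ≥ … ≥ |λ_n| and |λ₁| > 1, let C ∈ ℂ^{m×n}, and assume: (i) (C,A) is detectable; (ii) for every equi-modulus index set I = {j : |λ_j| = r} with r ≥ 1, the submatrix C_I of the columns of C indexed by I has rank |I| (all unstable and critically stable equi-blocks are non-degenerate); (iii) Q, R, Σ₀ are Hermitian positive definite. Let (γ_k) be i.i.d. Bernoulli with P(γ_k = 1) = p, and let P_k be the associated Riccati recursion. Then the critical value is p_c = 1 − |λ₁|^{−2}: if p > 1 − |λ₁|^{−2} then sup_k E[P_k] is bounded for every positive semidefinite initial condition Σ₀, and if p < 1 − |λ₁|^{−2} then sup_k E[P_k] is unbounded for some initial condition. -/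

import Mathlib

open Matrix MeasureTheory ProbabilityTheory
open scoped ComplexOrder ENNReal

/-- One step of the lossy Riccati recursion:
`X ↦ A X Aᴴ + Q − γ · A X Cᴴ (C X Cᴴ + R)⁻¹ C X Aᴴ`. -/
noncomputable def riccStep {ι κ : Type} [Fintype ι] [Fintype κ] [DecidableEq ι] [DecidableEq κ]
    (A : Matrix ι ι ℂ) (C : Matrix κ ι ℂ)
    (Q : Matrix ι ι ℂ) (R : Matrix κ κ ℂ) (g : ℝ)
    (X : Matrix ι ι ℂ) : Matrix ι ι ℂ :=
  A * X * Aᴴ + Q - (g : ℂ) • (A * X * Cᴴ * (C * X * Cᴴ + R)⁻¹ * (C * X * Aᴴ))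

/-- The lossy Riccati recursion `P₀ = S0`, `P_{k+1} = riccStep (γ k) (P k)`. -/
noncomputable def ricc {ι κ : Type} [Fintype ι] [Fintype κ] [DecidableEq ι] [DecidableEq κ]
    (A : Matrix ι ι ℂ) (C : Matrix κ ι ℂ)
    (Q : Matrix ι ι ℂ) (R : Matrix κ κ ℂ) (S0 : Matrix ι ι ℂ) (γ : ℕ → ℝ) :
    ℕ → Matrix ι ι ℂ
  | 0 => S0
  | k + 1 => riccStep A C Q R (γ k) (ricc A C Q R S0 γ k)

/-- Loewner order: `X ≤ Y` iff `Y - X` is positive semidefinite. -/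
def loe {ι : Type} [Fintype ι] (X Y : Matrix ι ι ℂ) : Prop := (Y - X).PosSemidef

/-- Entrywise expectation of a random matrix. -/
noncomputable def matExp {Ω ι κ : Type} [MeasurableSpace Ω] (μ : Measure Ω)
    (X : Ω → Matrix ι κ ℂ) : Matrix ι κ ℂ :=
  Matrix.of fun i j => ∫ ω, X ω i j ∂μ

/-- `sup_k E[P_k]` is bounded: the entries are integrable and there is a Hermitian matrix `M`
dominating every `E[P_k]` in the Loewner order. -/
def EBounded {Ω ι : Type} [Fintype ι] [MeasurableSpace Ω] (μ : Measure Ω)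
    (P : ℕ → Ω → Matrix ι ι ℂ) : Prop :=
  (∀ k i j, Integrable (fun ω => P k ω i j) μ) ∧
  ∃ M : Matrix ι ι ℂ, M.IsHermitian ∧ ∀ k, loe (matExp μ (P k)) M

/-- PBH detectability of `(C, A)`. -/
def Detectable {ι κ : Type} [Fintype ι] [Fintype κ] [DecidableEq ι]
    (A : Matrix ι ι ℂ) (C : Matrix κ ι ℂ) : Prop :=
  ∀ z : ℂ, 1 ≤ ‖z‖ →
    (Matrix.fromRows (A - z • (1 : Matrix ι ι ℂ)) C).rank = Fintype.card ι

/-- Non-degeneracy: for each equi-modulus index set `{j | |d j| = r}` the corresponding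
columns of `C` are linearly independent (i.e. `rank C_I = |I|`). -/
def NonDeg {ι κ : Type} (d : ι → ℂ) (C : Matrix κ ι ℂ) : Prop :=
  ∀ r : ℝ, LinearIndependent ℂ
    (fun j : {j : ι // ‖d j‖ = r} => fun i : κ => C i j.1)

set_option linter.unusedSectionVars false
set_option linter.unusedSimpArgs false

section MatrixPart
variable {ι κ : Type} [Fintype ι] [Fintype κ] [DecidableEq ι] [DecidableEq κ]

/-- the real quadratic form -/
noncomputable def qf (X : Matrix ι ι ℂ) (z : ι → ℂ) : ℝ := (star z ⬝ᵥ (X *ᵥ z)).re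

lemma qf_nonneg {X : Matrix ι ι ℂ} (hX : X.PosSemidef) (z : ι → ℂ) : 0 ≤ qf X z := by
  have := hX.dotProduct_mulVec_nonneg z
  exact (Complex.le_def.1 this).1

lemma qf_le (X : Matrix ι ι ℂ) (z : ι → ℂ) (b : ℝ) (hb : ∀ i, ‖z i‖ ^ 2 ≤ b) :
    qf X z ≤ (∑ i, ∑ j, ‖X i j‖) * b := by
  have h0 : qf X z ≤ ‖star z ⬝ᵥ (X *ᵥ z)‖ := Complex.re_le_norm _
  refine h0.trans ?_
  simp only [dotProduct, mulVec, Finset.mul_sum, Finset.sum_mul]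
  refine (norm_sum_le _ _).trans (Finset.sum_le_sum fun i _ => ?_)
  refine (norm_sum_le _ _).trans (Finset.sum_le_sum fun j _ => ?_)
  have : ‖z i‖ * ‖z j‖ ≤ b := by nlinarith [hb i, hb j, sq_nonneg (‖z i‖ - ‖z j‖)]
  simp only [Pi.star_apply, norm_mul, norm_star]
  nlinarith [norm_nonneg (X i j), mul_le_mul_of_nonneg_left this (norm_nonneg (X i j))]

lemma posDef_S {C : Matrix κ ι ℂ} {R : Matrix κ κ ℂ} (hR : R.PosDef) {X : Matrix ι ι ℂ}
    (hX : X.PosSemidef) : (C * X * Cᴴ + R).PosDef :=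
  hR.posSemidef_add (hX.mul_mul_conjTranspose_same C)

lemma riccStep_one_eq (A : Matrix ι ι ℂ) (C : Matrix κ ι ℂ)
    (Q : Matrix ι ι ℂ) {R : Matrix κ κ ℂ} (hR : R.PosDef)
    {X : Matrix ι ι ℂ} (hX : X.PosSemidef) (K : Matrix ι κ ℂ) :
    riccStep A C Q R 1 X = (A - K * C) * X * (A - K * C)ᴴ + K * R * Kᴴ + Q
      - (K - A * X * Cᴴ * (C * X * Cᴴ + R)⁻¹) * (C * X * Cᴴ + R)
        * (K - A * X * Cᴴ * (C * X * Cᴴ + R)⁻¹)ᴴ := by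
  have hS := posDef_S (C := C) hR hX
  set S := C * X * Cᴴ + R with hSdef
  have hR' : R = S - C * X * Cᴴ := by rw [hSdef]; abel
  have hdet : IsUnit S.det := (Matrix.isUnit_iff_isUnit_det _).1 hS.isUnit
  have h1 : S⁻¹ * S = 1 := Matrix.nonsing_inv_mul _ hdet
  have h2 : S * S⁻¹ = 1 := Matrix.mul_nonsing_inv _ hdet
  have hSi : (S⁻¹)ᴴ = S⁻¹ := hS.inv.isHermitian
  have hXh : Xᴴ = X := hX.isHermitian
  have e1 : ∀ Y : Matrix κ ι ℂ, S⁻¹ * (S * Y) = Y := fun Y => by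
    rw [← Matrix.mul_assoc, h1, Matrix.one_mul]
  have e2 : ∀ Y : Matrix κ ι ℂ, S * (S⁻¹ * Y) = Y := fun Y => by
    rw [← Matrix.mul_assoc, h2, Matrix.one_mul]
  unfold riccStep
  rw [← hSdef]
  rw [hR']
  simp only [Complex.ofReal_one, one_smul, conjTranspose_sub, conjTranspose_mul, hSi, hXh,
    conjTranspose_conjTranspose, Matrix.sub_mul, Matrix.mul_sub, Matrix.mul_assoc, e1, e2]
  abel

lemma riccStep_zero_eq (A : Matrix ι ι ℂ) (C : Matrix κ ι ℂ)
    (Q : Matrix ι ι ℂ) (R : Matrix κ κ ℂ) (X : Matrix ι ι ℂ) :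
    riccStep A C Q R 0 X = A * X * Aᴴ + Q := by
  simp [riccStep]

lemma riccStep_psd (A : Matrix ι ι ℂ) (C : Matrix κ ι ℂ)
    {Q : Matrix ι ι ℂ} (hQ : Q.PosDef) {R : Matrix κ κ ℂ} (hR : R.PosDef)
    {X : Matrix ι ι ℂ} (hX : X.PosSemidef) (g : ℝ) (hg : g = 0 ∨ g = 1) :
    (riccStep A C Q R g X).PosSemidef := by
  rcases hg with rfl | rfl
  · rw [riccStep_zero_eq]
    exact (hX.mul_mul_conjTranspose_same A).add hQ.posSemidef
  · rw [riccStep_one_eq A C Q hR hX (A * X * Cᴴ * (C * X * Cᴴ + R)⁻¹)]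
    simp only [sub_self, Matrix.zero_mul, sub_zero]
    exact ((hX.mul_mul_conjTranspose_same _).add
      (hR.posSemidef.mul_mul_conjTranspose_same _)).add hQ.posSemidef

lemma qf_add (X Y : Matrix ι ι ℂ) (z : ι → ℂ) : qf (X + Y) z = qf X z + qf Y z := by
  simp [qf, add_mulVec, dotProduct_add]

lemma qf_conj (X : Matrix κ κ ℂ) (B : Matrix ι κ ℂ) (z : ι → ℂ) :
    qf (B * X * Bᴴ) z = qf X (Bᴴ *ᵥ z) := by
  simp [qf, ← mulVec_mulVec, star_mulVec, dotProduct_mulVec, vecMul_vecMul, Matrix.mul_assoc]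

lemma ricc_psd (A : Matrix ι ι ℂ) (C : Matrix κ ι ℂ)
    {Q : Matrix ι ι ℂ} (hQ : Q.PosDef) {R : Matrix κ κ ℂ} (hR : R.PosDef)
    {S0 : Matrix ι ι ℂ} (hS : S0.PosSemidef) (g : ℕ → ℝ) (hg : ∀ k, g k = 0 ∨ g k = 1) (k : ℕ) :
    (ricc A C Q R S0 g k).PosSemidef := by
  induction k with
  | zero => exact hS
  | succ k ih => exact riccStep_psd A C hQ hR ih _ (hg k)

/-- The dynamic programming inequality. -/
lemma qf_riccStep_le (A : Matrix ι ι ℂ) (C : Matrix κ ι ℂ)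
    (Q : Matrix ι ι ℂ) {R : Matrix κ κ ℂ} (hR : R.PosDef)
    {X : Matrix ι ι ℂ} (hX : X.PosSemidef) (g : ℝ) (hg : g = 0 ∨ g = 1) (z : ι → ℂ) (u : κ → ℂ)
    (hu : g = 0 → u = 0) :
    qf (riccStep A C Q R g X) z ≤ qf X (Aᴴ *ᵥ z - Cᴴ *ᵥ u) + qf R u + qf Q z := by
  rcases hg with rfl | rfl
  · rw [riccStep_zero_eq, qf_add, qf_conj, hu rfl]
    simp [qf]
  · have hS := posDef_S (C := C) hR hX
    set S := C * X * Cᴴ + R with hSdef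
    have hdet : IsUnit S.det := (Matrix.isUnit_iff_isUnit_det _).1 hS.isUnit
    have h1 : S⁻¹ * S = 1 := Matrix.nonsing_inv_mul _ hdet
    have h2 : S * S⁻¹ = 1 := Matrix.mul_nonsing_inv _ hdet
    have hXh : Xᴴ = X := hX.isHermitian
    have key := qf_nonneg hS.inv.posSemidef (S *ᵥ u - (C * X) *ᵥ (Aᴴ *ᵥ z))
    have hSh : Sᴴ = S := hS.isHermitian
    have hR' : R = S - C * X * Cᴴ := by rw [hSdef]; abel
    suffices h : qf X (Aᴴ *ᵥ z - Cᴴ *ᵥ u) + qf R u + qf Q z - qf (riccStep A C Q R 1 X) z =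
      qf S⁻¹ (S *ᵥ u - (C * X) *ᵥ (Aᴴ *ᵥ z)) by linarith
    unfold riccStep
    rw [← hSdef]
    rw [hR']
    have e1 : ∀ Y : Matrix κ ι ℂ, S⁻¹ * (S * Y) = Y := fun Y => by
      rw [← Matrix.mul_assoc, h1, Matrix.one_mul]
    have e2 : ∀ Y : Matrix κ ι ℂ, S * (S⁻¹ * Y) = Y := fun Y => by
      rw [← Matrix.mul_assoc, h2, Matrix.one_mul]
    simp only [qf, ← Complex.add_re, ← Complex.sub_re]
    congr 1
    simp only [Complex.ofReal_one, one_smul, mulVec_sub, sub_mulVec, star_sub, add_mulVec,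
      dotProduct_sub, sub_dotProduct, dotProduct_add, star_mulVec, dotProduct_mulVec, vecMul_vecMul,
      mulVec_mulVec, conjTranspose_mul, conjTranspose_conjTranspose, hXh, hSh, Matrix.mul_assoc, e1, e2, h1, h2,
      Matrix.mul_one, sub_vecMul, vecMul_one]
    ring

/-- Cost bound for an arbitrary control sequence. -/
lemma qf_ricc_le (A : Matrix ι ι ℂ) (C : Matrix κ ι ℂ)
    {Q : Matrix ι ι ℂ} (hQ : Q.PosDef) {R : Matrix κ κ ℂ} (hR : R.PosDef)
    {S0 : Matrix ι ι ℂ} (hS : S0.PosSemidef) (g : ℕ → ℝ) (hg : ∀ k, g k = 0 ∨ g k = 1) (k : ℕ)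
    (z : ℕ → ι → ℂ) (u : ℕ → κ → ℂ)
    (hz : ∀ τ, τ < k → z (τ + 1) = Aᴴ *ᵥ z τ - Cᴴ *ᵥ u τ)
    (hu : ∀ τ, τ < k → g (k - 1 - τ) = 0 → u τ = 0) :
    qf (ricc A C Q R S0 g k) (z 0) ≤ qf S0 (z k) +
      ∑ τ ∈ Finset.range k, (qf R (u τ) + qf Q (z τ)) := by
  have : ∀ t, t ≤ k → qf (ricc A C Q R S0 g k) (z 0) ≤ qf (ricc A C Q R S0 g (k - t)) (z t) +
      ∑ τ ∈ Finset.range t, (qf R (u τ) + qf Q (z τ)) := by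
    intro t
    induction t with
    | zero => intro _; simp
    | succ t ih =>
      intro ht
      refine (ih (by omega)).trans ?_
      rw [Finset.sum_range_succ]
      obtain ⟨l, hl⟩ : ∃ l, k - t = l + 1 := ⟨k - t - 1, by omega⟩
      have hl2 : k - (t + 1) = l := by omega
      have hl3 : k - 1 - t = l := by omega
      have := qf_riccStep_le A C Q hR (ricc_psd A C hQ hR hS g hg l) (g l) (hg l) (z t) (u t)
        (fun h => hu t (by omega) (by rw [hl3]; exact h))
      rw [hl, hl2, hz t (by omega)]
      change qf (riccStep A C Q R (g l) (ricc A C Q R S0 g l)) (z t) + _ ≤ _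
      linarith
  simpa [ricc] using this k le_rfl

end MatrixPart


section Weights

lemma weights_aux (σ : ℕ → ℝ) (hσ : ∀ l, 0 ≤ σ l) (T : ℕ → ℕ) (hT : Monotone T) (a : ℕ → ℝ)
    (ha0 : 0 ≤ a 0) (ha : ∀ l, a (l + 1) = a l * σ l ^ (T (l + 1) - T l)) :
    (∀ l, 0 ≤ a l) ∧
    (∀ s : ℝ, 0 ≤ s → ∀ l l', l ≤ l' → (∀ i, l ≤ i → i < l' → s ≤ σ i) →
      a l * s ^ (T l' - T l) ≤ a l') ∧
    (∀ s : ℝ, 0 ≤ s → ∀ l l', l ≤ l' → (∀ i, l ≤ i → i < l' → σ i ≤ s) →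
      a l' ≤ a l * s ^ (T l' - T l)) := by
  have hnn : ∀ l, 0 ≤ a l := by
    intro l
    induction l with
    | zero => exact ha0
    | succ l ih => rw [ha]; exact mul_nonneg ih (pow_nonneg (hσ l) _)
  have hsplit : ∀ l l', l ≤ l' → T (l' + 1) - T l = (T l' - T l) + (T (l' + 1) - T l') := by
    intro l l' h
    have h1 := hT h
    have h2 := hT (Nat.le_succ l')
    simp only [Nat.succ_eq_add_one] at h2
    omega
  refine ⟨hnn, ?_, ?_⟩
  · intro s hs l l' hl
    induction l', hl using Nat.le_induction with
    | base => intro _; simp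
    | succ l' hl ih =>
      intro h
      rw [hsplit l l' hl, pow_add, ha, ← mul_assoc]
      have := ih (fun i h1 h2 => h i h1 (by omega))
      have h3 := h l' hl (by omega)
      exact mul_le_mul this (pow_le_pow_left₀ hs h3 _) (by positivity) (hnn _)
  · intro s hs l l' hl
    induction l', hl using Nat.le_induction with
    | base => intro _; simp
    | succ l' hl ih =>
      intro h
      rw [hsplit l l' hl, pow_add, ha, ← mul_assoc]
      have := ih (fun i h1 h2 => h i h1 (by omega))
      have h3 := h l' hl (by omega)
      exact mul_le_mul this (pow_le_pow_left₀ (hσ _) h3 _) (pow_nonneg (hσ _) _)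
        (mul_nonneg (hnn _) (pow_nonneg hs _))

/-- existence of the ranking and of the weights -/
lemma weights_exist {U : Type} [Fintype U] (ρ : U → ℝ) (hpos : ∀ q, 0 < ρ q) (q0 : U)
    (hmax : ∀ q, ρ q ≤ ρ q0) (ε : ℝ) (hε : 0 < ε) :
    ∃ (L : ℕ) (c : U → ℕ), 1 ≤ L ∧ (∀ q, c q < Fintype.card U) ∧
      (∀ q j, ρ q = ρ j → c q = c j) ∧
      ∀ T : ℕ → ℕ, (∀ l, T l + L ≤ T (l + 1)) → ∃ α : U → ℝ,
        (∀ q, ρ q ^ T (c q) ≤ α q) ∧ (∀ q, α q ≤ ρ q0 ^ T (c q)) ∧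
        (∀ q j, ρ q ≠ ρ j → ρ q ^ T (c q) * (ρ q)⁻¹ ^ T (c j) * α j ≤ ε * α q) := by
  classical
  obtain ⟨θ, hθ0, hθ1, hθ⟩ : ∃ θ : ℝ, 0 < θ ∧ θ < 1 ∧ ∀ q j, ρ q < ρ j → ρ q < θ ^ 2 * ρ j := by
    have h1 : ∀ᶠ θ : ℝ in nhdsWithin 1 (Set.Iio 1), 0 < θ :=
      nhdsWithin_le_nhds (lt_mem_nhds one_pos)
    have h2 : ∀ᶠ θ : ℝ in nhdsWithin 1 (Set.Iio 1), θ < 1 := self_mem_nhdsWithin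
    have h3 : ∀ᶠ θ : ℝ in nhdsWithin 1 (Set.Iio 1), ∀ q j, ρ q < ρ j → ρ q < θ ^ 2 * ρ j := by
      rw [Filter.eventually_all]; intro q
      rw [Filter.eventually_all]; intro j
      by_cases h : ρ q < ρ j
      · have : Filter.Tendsto (fun θ : ℝ => θ ^ 2 * ρ j) (nhds 1) (nhds (1 ^ 2 * ρ j)) :=
          (Continuous.tendsto (by fun_prop) 1)
        rw [one_pow, one_mul] at this
        have := this.eventually (lt_mem_nhds h)
        filter_upwards [nhdsWithin_le_nhds this] with θ hθ _ using hθ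
      · exact Filter.Eventually.of_forall fun _ h' => absurd h' h
    obtain ⟨θ, h⟩ := (h1.and (h2.and h3)).exists
    exact ⟨θ, h⟩
  let c : U → ℕ := fun q => (Finset.univ.filter fun j => ρ q < ρ j).card
  have hc_lt : ∀ q j, ρ q < ρ j → c j < c q := by
    intro q j h
    refine Finset.card_lt_card ?_
    rw [Finset.ssubset_iff_of_subset]
    · exact ⟨j, by simpa using h, by simp⟩
    · intro i hi
      simp only [Finset.mem_filter, Finset.mem_univ, true_and] at hi ⊢
      exact h.trans hi
  have hc_eq : ∀ q j, ρ q = ρ j → c q = c j := by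
    intro q j h; simp only [c, h]
  have hc_iff : ∀ q j, c j < c q → ρ q < ρ j := by
    intro q j h
    by_contra! h'
    rcases h'.lt_or_eq with h' | h'
    · exact absurd (hc_lt _ _ h') (by omega)
    · rw [hc_eq _ _ h'] at h; omega
  have hσ : ∀ l, ∃ s : ℝ, 0 ≤ s ∧ (∀ q, l < c q → ρ q ≤ θ * s) ∧ (∀ j, c j ≤ l → s ≤ θ * ρ j) := by
    intro l
    by_cases hne : (Finset.univ.filter fun q => l < c q).Nonempty
    · obtain ⟨m, hm, hmm⟩ := Finset.exists_max_image _ ρ hne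
      simp only [Finset.mem_filter, Finset.mem_univ, true_and] at hm hmm
      refine ⟨ρ m / θ, by have := hpos m; positivity, ?_, ?_⟩
      · intro q hq
        rw [mul_div_cancel₀ _ hθ0.ne']
        exact hmm q hq
      · intro j hj
        rw [div_le_iff₀ hθ0]
        have := hθ m j (hc_iff m j (by omega))
        nlinarith
    · refine ⟨0, le_rfl, ?_, ?_⟩
      · intro q hq
        exact absurd ⟨q, by simpa using hq⟩ hne
      · intro j _
        have := hpos j; positivity
  choose σ hσ0 hσ1 hσ2 using hσ
  obtain ⟨L0, hL0⟩ := exists_pow_lt_of_lt_one hε hθ1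
  have hL : ∀ e, L0 + 1 ≤ e → θ ^ e ≤ ε := fun e he =>
    (pow_le_pow_of_le_one hθ0.le hθ1.le (by omega)).trans hL0.le
  refine ⟨L0 + 1, c, by omega, ?_, hc_eq, ?_⟩
  · intro q
    refine Finset.card_lt_card ?_ |>.trans_le (le_of_eq Finset.card_univ)
    rw [Finset.ssubset_univ_iff]
    intro h
    have : q ∈ Finset.univ.filter fun j => ρ q < ρ j := by rw [h]; exact Finset.mem_univ _
    simp at this
  intro T hT
  have hTm : Monotone T := monotone_nat_of_le_succ fun l => by have := hT l; omega
  have hTL : ∀ l l', l < l' → T l + (L0 + 1) ≤ T l' := by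
    intro l l' h
    exact (hT l).trans (hTm h)
  let a : ℕ → ℝ := fun l => Nat.rec (ρ q0 ^ T 0) (fun l b => b * σ l ^ (T (l + 1) - T l)) l
  have hρ0 := hpos q0
  obtain ⟨hnn, hlow, hup⟩ := weights_aux σ hσ0 T hTm a
    (pow_nonneg hρ0.le _ : (0 : ℝ) ≤ ρ q0 ^ T 0) (fun l => rfl)
  have hc0 : c q0 = 0 := by
    by_contra h
    have : 0 < c q0 := by omega
    obtain ⟨j, hj⟩ := Finset.card_pos.1 this
    simp only [Finset.mem_filter, Finset.mem_univ, true_and] at hj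
    exact absurd (hmax j) (not_le.2 hj)
  refine ⟨fun q => a (c q), ?_, ?_, ?_⟩
  · intro q
    have h := hlow (ρ q) (hpos q).le 0 (c q) (by omega) (fun i _ hi => by
      have := hσ1 i q hi
      have := hσ0 i
      nlinarith)
    refine le_trans ?_ h
    have h0 : T 0 ≤ T (c q) := hTm (by omega)
    have : ρ q ^ T (c q) = ρ q ^ T 0 * ρ q ^ (T (c q) - T 0) := by
      rw [← pow_add]; congr 1; omega
    rw [this]
    exact mul_le_mul_of_nonneg_right (pow_le_pow_left₀ (hpos q).le (hmax q) _)
      (pow_nonneg (hpos q).le _)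
  · intro q
    have h := hup (ρ q0) hρ0.le 0 (c q) (by omega) (fun i _ hi => by
      have := hσ2 i q0 (by omega)
      nlinarith)
    refine h.trans (le_of_eq ?_)
    have h0 : T 0 ≤ T (c q) := hTm (by omega)
    change ρ q0 ^ T 0 * _ = _
    rw [← pow_add]; congr 1; omega
  · intro q j hne
    have hq := hpos q
    rcases lt_or_gt_of_ne hne with h | h
    · have hcc := hc_lt _ _ h
      have hl := hlow (ρ q / θ) (by positivity) (c j) (c q) hcc.le (fun i _ hi => by
        rw [div_le_iff₀ hθ0, mul_comm]
        exact hσ1 i q hi)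
      have hTT := hTL _ _ hcc
      have e : ρ q ^ T (c q) * (ρ q)⁻¹ ^ T (c j) = ρ q ^ (T (c q) - T (c j)) := by
        rw [inv_pow, pow_sub₀ _ hq.ne' (by omega)]
      rw [e]
      rw [div_pow] at hl
      have hpw : (0 : ℝ) < θ ^ (T (c q) - T (c j)) := by positivity
      have h5 : ρ q ^ (T (c q) - T (c j)) * a (c j) ≤ θ ^ (T (c q) - T (c j)) * a (c q) := by
        rw [← mul_div_assoc, div_le_iff₀ hpw] at hl
        nlinarith
      exact h5.trans (mul_le_mul_of_nonneg_right (hL _ (by omega)) (hnn _))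
    · have hcc := hc_lt _ _ h
      have hl := hup (θ * ρ q) (by positivity) (c q) (c j) hcc.le (fun i hi _ => hσ2 i q hi)
      have hTT := hTL _ _ hcc
      have e : ρ q ^ T (c q) * (ρ q)⁻¹ ^ T (c j) = (ρ q ^ (T (c j) - T (c q)))⁻¹ := by
        rw [inv_pow, pow_sub₀ _ hq.ne' (by omega)]
        field_simp
      rw [e, inv_mul_le_iff₀ (by positivity)]
      rw [mul_pow] at hl
      refine hl.trans ?_
      have h6 := mul_le_mul_of_nonneg_right (hL (T (c j) - T (c q)) (by omega))
        (mul_nonneg (pow_nonneg hq.le (T (c j) - T (c q))) (hnn (c q)))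
      nlinarith

/-- solving the diagonally dominant system -/
lemma solve_system {U : Type} [Fintype U] [DecidableEq U] (D : U → ℂ) (hD : ∀ q, D q ≠ 0)
    (M : U → U → ℂ) (K : ℝ) (hK0 : 0 ≤ K) (hK : ∀ q j, ‖M q j‖ ≤ K)
    (hM : ∀ q j, ‖D q‖ = ‖D j‖ → M q j = if q = j then 1 else 0)
    (t : U → ℕ) (α : U → ℝ) (ε : ℝ) (hε0 : 0 ≤ ε) (hε : ε * (K * Fintype.card U) ≤ 1 / 2)
    (hα1 : ∀ q, ‖D q‖ ^ t q ≤ α q)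
    (hα3 : ∀ q j, ‖D q‖ ≠ ‖D j‖ → ‖D q‖ ^ t q * ‖D q‖⁻¹ ^ t j * α j ≤ ε * α q)
    (y : U → ℂ) (B : ℝ) (hB : 0 ≤ B) (hy : ∀ q, ‖y q‖ ≤ B) :
    ∃ w : U → ℂ, (∀ q, ∑ j, (D q)⁻¹ ^ t j * M q j * w j = y q) ∧
      ∀ q, ‖w q‖ ≤ 2 * B * α q := by
  classical
  have hα0 : ∀ q, 0 < α q := fun q =>
    (pow_pos (norm_pos_iff.2 (hD q)) _).trans_le (hα1 q)
  let Φ : (U → ℂ) →ₗ[ℂ] (U → ℂ) :=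
    { toFun := fun w q => ∑ j, (D q)⁻¹ ^ t j * M q j * w j
      map_add' := by
        intro w w'; ext q
        simp [mul_add, Finset.sum_add_distrib]
      map_smul' := by
        intro r w; ext q
        simp only [Pi.smul_apply, smul_eq_mul, RingHom.id_apply, Finset.mul_sum]
        refine Finset.sum_congr rfl fun j _ => by ring }
  have key : ∀ (w : U → ℂ) (B : ℝ), 0 ≤ B → (∀ q, ‖Φ w q‖ ≤ B) → ∀ q, ‖w q‖ ≤ 2 * B * α q := by
    intro w B hB hw q1
    obtain ⟨q, -, hq⟩ := Finset.exists_max_image Finset.univ (fun q => ‖w q‖ / α q)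
      ⟨q1, Finset.mem_univ _⟩
    set m := ‖w q‖ / α q with hm
    have hm0 : 0 ≤ m := div_nonneg (norm_nonneg _) (hα0 q).le
    have hwj : ∀ j, ‖w j‖ ≤ m * α j := fun j => by
      have := hq j (Finset.mem_univ _)
      rwa [div_le_iff₀ (hα0 j)] at this
    have hwq : ‖w q‖ = m * α q := by rw [hm, div_mul_cancel₀ _ (hα0 q).ne']
    have e1 : D q ^ t q * Φ w q = w q +
        ∑ j ∈ Finset.univ.erase q, D q ^ t q * ((D q)⁻¹ ^ t j * M q j * w j) := by
      change D q ^ t q * ∑ j, (D q)⁻¹ ^ t j * M q j * w j = _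
      rw [← Finset.add_sum_erase _ _ (Finset.mem_univ q), mul_add, Finset.mul_sum, hM q q rfl]
      congr 1
      rw [if_pos rfl, mul_one, ← mul_assoc, ← mul_pow, mul_inv_cancel₀ (hD q), one_pow, one_mul]
    have e2 : ∀ j ∈ Finset.univ.erase q, ‖D q ^ t q * ((D q)⁻¹ ^ t j * M q j * w j)‖ ≤
        ε * K * m * α q := by
      intro j hj
      have hjq : q ≠ j := fun h => by simp [h] at hj
      by_cases hn : ‖D q‖ = ‖D j‖
      · rw [hM q j hn, if_neg hjq]
        have h8 := hα0 q
        have : 0 ≤ ε * K * m * α q := by positivity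
        simpa using this
      · have h7 := hα3 q j hn
        rw [norm_mul, norm_mul, norm_mul, norm_pow, norm_pow, norm_inv]
        calc ‖D q‖ ^ t q * (‖D q‖⁻¹ ^ t j * ‖M q j‖ * ‖w j‖)
            ≤ ‖D q‖ ^ t q * (‖D q‖⁻¹ ^ t j * K * (m * α j)) := by
              gcongr
              · exact hK q j
              · exact hwj j
          _ = (‖D q‖ ^ t q * ‖D q‖⁻¹ ^ t j * α j) * (K * m) := by ring
          _ ≤ (ε * α q) * (K * m) := by gcongr
          _ = _ := by ring
    have e3 : ‖∑ j ∈ Finset.univ.erase q, D q ^ t q * ((D q)⁻¹ ^ t j * M q j * w j)‖ ≤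
        m * α q / 2 := by
      refine (norm_sum_le_of_le _ e2).trans ?_
      rw [Finset.sum_const, nsmul_eq_mul]
      have h8 := hα0 q
      have h9 : ((Finset.univ.erase q).card : ℝ) ≤ Fintype.card U := by
        exact_mod_cast Finset.card_le_univ _
      calc ((Finset.univ.erase q).card : ℝ) * (ε * K * m * α q)
          ≤ Fintype.card U * (ε * K * m * α q) := by gcongr
        _ = (ε * (K * Fintype.card U)) * (m * α q) := by ring
        _ ≤ (1 / 2) * (m * α q) := by gcongr
        _ = _ := by ring
    have e4 : ‖D q ^ t q * Φ w q‖ ≤ α q * B := by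
      rw [norm_mul, norm_pow]
      exact mul_le_mul (hα1 q) (hw q) (norm_nonneg _) (hα0 q).le
    have e5 : ‖w q‖ ≤ α q * B + m * α q / 2 := by
      have : w q = D q ^ t q * Φ w q -
        ∑ j ∈ Finset.univ.erase q, D q ^ t q * ((D q)⁻¹ ^ t j * M q j * w j) := by rw [e1]; ring
      rw [this]
      exact (norm_sub_le _ _).trans (add_le_add e4 e3)
    have e6 : m ≤ 2 * B := by
      have h8 := hα0 q
      rw [hwq] at e5
      have : m * α q ≤ 2 * B * α q := by linarith
      exact le_of_mul_le_mul_right this h8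
    exact (hwj q1).trans (mul_le_mul_of_nonneg_right e6 (hα0 q1).le)
  have hinj : Function.Injective Φ := by
    rw [injective_iff_map_eq_zero]
    intro w hw
    ext q
    have := key w 0 le_rfl (fun q => by rw [hw]; simp) q
    simpa using this
  have hsurj : Function.Surjective Φ := LinearMap.surjective_of_injective hinj
  obtain ⟨w, hw⟩ := hsurj y
  exact ⟨w, fun q => congrFun hw q, key w B hB (fun q => by rw [hw]; exact hy q)⟩

end Weights


section Control

lemma dual_vectors {n m : ℕ} (d : Fin (n + 1) → ℂ) (C : Matrix (Fin m) (Fin (n + 1)) ℂ)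
    (r : ℝ) (h : LinearIndependent ℂ
      (fun j : {j : Fin (n + 1) // ‖d j‖ = r} => fun i : Fin m => C i j.1))
    (q : Fin (n + 1)) (hq : ‖d q‖ = r) :
    ∃ b : Fin m → ℂ, ∀ j, ‖d j‖ = r → (Cᴴ *ᵥ b) j = if q = j then 1 else 0 := by
  classical
  obtain ⟨g, hg⟩ := LinearMap.exists_leftInverse_of_injective _ (LinearMap.ker_eq_bot.2 h)
  let f : (Fin m → ℂ) →ₗ[ℂ] ℂ := (Finsupp.lapply ⟨q, hq⟩) ∘ₗ g
  refine ⟨fun i => star (f (Pi.single i 1)), ?_⟩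
  intro j hj
  have h1 : f (fun i => C i j) = if q = j then 1 else 0 := by
    have := LinearMap.congr_fun hg (Finsupp.single ⟨j, hj⟩ 1)
    simp only [LinearMap.comp_apply, Finsupp.linearCombination_single, one_smul,
      LinearMap.id_apply] at this
    change (g (fun i => C i j)) ⟨q, hq⟩ = _
    rw [this, Finsupp.single_apply]
    simp [Subtype.ext_iff, eq_comm]
  have h2 : f (fun i => C i j) = ∑ i, C i j * f (Pi.single i 1) := by
    conv_lhs => rw [LinearMap.pi_apply_eq_sum_univ f (fun i => C i j)]
    refine Finset.sum_congr rfl fun i _ => ?_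
    rw [smul_eq_mul]
    congr 2
    ext l
    simp [Pi.single_apply, eq_comm]
  have h3 : (Cᴴ *ᵥ fun i => star (f (Pi.single i 1))) j = star (f (fun i => C i j)) := by
    rw [h2]
    simp [mulVec, dotProduct, conjTranspose_apply, star_sum, mul_comm]
  rw [h3, h1]
  split_ifs <;> simp

lemma ctrl_exists {n m : ℕ} (d : Fin (n + 1) → ℂ) (C : Matrix (Fin m) (Fin (n + 1)) ℂ)
    (hmax : ∀ j, ‖d j‖ ≤ ‖d 0‖)
    (hunst : 1 < ‖d 0‖)
    (hnd : ∀ r : ℝ, 1 ≤ r → LinearIndependent ℂ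
      (fun j : {j : Fin (n + 1) // ‖d j‖ = r} => fun i : Fin m => C i j.1)) :
    ∃ (L : ℕ) (K : ℝ), 1 ≤ L ∧ 0 ≤ K ∧ ∀ T : ℕ → ℕ, (∀ l, T l + L ≤ T (l + 1)) →
      ∀ (v : Fin (n + 1) → ℂ) (V : ℝ), 0 ≤ V → (∀ i, ‖v i‖ ≤ V) →
      ∃ (z : ℕ → Fin (n + 1) → ℂ) (u : ℕ → Fin m → ℂ), z 0 = v ∧
        (∀ τ, z (τ + 1) = (Matrix.diagonal d)ᴴ *ᵥ z τ - Cᴴ *ᵥ u τ) ∧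
        (∀ τ, u τ ≠ 0 → ∃ l, l ≤ n ∧ τ = T l) ∧
        (∀ τ i, ‖z τ i‖ ≤ K * V * ‖d 0‖ ^ τ) ∧
        (∀ τ i, ‖u τ i‖ ≤ K * V * ‖d 0‖ ^ τ) ∧
        (∀ τ i, T n < τ → 1 ≤ ‖d i‖ → z τ i = 0) := by
  classical
  set ρ := ‖d 0‖ with hρ
  let U := {q : Fin (n + 1) // 1 ≤ ‖d q‖}
  have hb : ∀ q : U, ∃ b : Fin m → ℂ, ∀ j, ‖d j‖ = ‖d q.1‖ →
      (Cᴴ *ᵥ b) j = if q.1 = j then 1 else 0 := fun q =>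
    dual_vectors d C ‖d q.1‖ (hnd _ q.2) q.1 rfl
  choose b hb using hb
  let D : Fin (n + 1) → ℂ := fun q => star (d q)
  have hDn : ∀ q, ‖D q‖ = ‖d q‖ := fun q => norm_star _
  let M : Fin (n + 1) → U → ℂ := fun q j => (Cᴴ *ᵥ b j) q
  obtain ⟨K, hK0, hK, hKb⟩ : ∃ K : ℝ, 0 ≤ K ∧ (∀ q j, ‖M q j‖ ≤ K) ∧ ∀ j i, ‖b j i‖ ≤ K := by
    refine ⟨(∑ q, ∑ j, ‖M q j‖) + ∑ j, ∑ i, ‖b j i‖, by positivity, fun q j => ?_, fun j i => ?_⟩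
    · have h1 : ‖M q j‖ ≤ ∑ j, ‖M q j‖ :=
        Finset.single_le_sum (f := fun j => ‖M q j‖) (fun _ _ => norm_nonneg _) (Finset.mem_univ j)
      have h2 : ∑ j, ‖M q j‖ ≤ ∑ q, ∑ j, ‖M q j‖ :=
        Finset.single_le_sum (f := fun q => ∑ j, ‖M q j‖)
          (fun _ _ => by positivity) (Finset.mem_univ q)
      have h3 : 0 ≤ ∑ j, ∑ i, ‖b j i‖ := by positivity
      linarith
    · have h1 : ‖b j i‖ ≤ ∑ i, ‖b j i‖ :=
        Finset.single_le_sum (f := fun i => ‖b j i‖) (fun _ _ => norm_nonneg _) (Finset.mem_univ i)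
      have h2 : ∑ i, ‖b j i‖ ≤ ∑ j, ∑ i, ‖b j i‖ :=
        Finset.single_le_sum (f := fun j => ∑ i, ‖b j i‖)
          (fun _ _ => by positivity) (Finset.mem_univ j)
      have h3 : 0 ≤ ∑ q, ∑ j, ‖M q j‖ := by positivity
      linarith
  let ε : ℝ := 1 / (2 * (K * Fintype.card U + 1))
  have hcard0 : (0 : ℝ) ≤ K * Fintype.card U := by positivity
  have hε : 0 < ε := by positivity
  have hε2 : ε * (K * Fintype.card U) ≤ 1 / 2 := by
    simp only [ε]
    rw [div_mul_eq_mul_div, div_le_div_iff₀ (by positivity) (by positivity)]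
    linarith
  obtain ⟨L, c, hL, hc, hceq, hw⟩ := weights_exist (fun q : U => ‖d q.1‖)
    (fun q => one_pos.trans_le q.2) ⟨0, hunst.le⟩ (fun q => hmax _) ε hε
  have hcn : ∀ q, c q ≤ n := fun q => by
    have h1 := hc q
    have h2 : Fintype.card U ≤ Fintype.card (Fin (n + 1)) := Fintype.card_subtype_le _
    rw [Fintype.card_fin] at h2
    omega
  let N : ℝ := Fintype.card U
  have hN0 : 0 ≤ N := by positivity
  have hρ0 : 0 < ρ := one_pos.trans hunst
  refine ⟨L, 1 + N * K * (2 * ρ), hL, by positivity, ?_⟩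
  intro T hT v V hV hv
  obtain ⟨α, hα1, hα2, hα3⟩ := hw T hT
  have hTm : Monotone T := monotone_nat_of_le_succ fun l => by have := hT l; omega
  obtain ⟨w, hwe, hwb⟩ := solve_system (fun q : U => D q.1)
    (fun q h => by
      have := q.2
      rw [← hDn, h, norm_zero] at this
      linarith)
    (fun q j => M q.1 j) K hK0 (fun q j => hK _ _)
    (fun q j h => by
      simp only [hDn] at h
      simp only [M]
      rw [hb j q.1 h]
      by_cases hqj : q = j
      · rw [if_pos hqj, if_pos (by rw [hqj])]
      · rw [if_neg hqj, if_neg (fun h' => hqj (Subtype.ext h'.symm))])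
    (fun q => T (c q)) α ε hε.le hε2
    (fun q => by rw [hDn]; exact hα1 q)
    (fun q j h => by
      simp only [hDn] at h ⊢
      exact hα3 q j h)
    (fun q => D q.1 * v q.1) (ρ * V) (by positivity)
    (fun q => by
      rw [norm_mul, hDn]
      exact mul_le_mul (hmax _) (hv _) (norm_nonneg _) hρ0.le)
  have hwb' : ∀ j, ‖w j‖ ≤ 2 * ρ * V * ρ ^ T (c j) := fun j => by
    refine (hwb j).trans ?_
    have := hα2 j
    simp only at this
    rw [← hρ] at this
    have h2 : 0 ≤ 2 * (ρ * V) := by positivity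
    calc 2 * (ρ * V) * α j ≤ 2 * (ρ * V) * ρ ^ T (c j) := mul_le_mul_of_nonneg_left this h2
      _ = _ := by ring
  refine ⟨fun τ q => D q ^ τ * v q -
      ∑ j : U, if T (c j) < τ then D q ^ (τ - 1 - T (c j)) * M q j * w j else 0,
    fun τ => ∑ j : U, if T (c j) = τ then w j • b j else 0, ?_, ?_, ?_, ?_, ?_, ?_⟩
  · ext q; simp
  · intro τ
    ext q
    have h1 : ((Matrix.diagonal d)ᴴ *ᵥ fun q => D q ^ τ * v q -
      ∑ j : U, if T (c j) < τ then D q ^ (τ - 1 - T (c j)) * M q j * w j else 0) q =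
      D q * (D q ^ τ * v q -
      ∑ j : U, if T (c j) < τ then D q ^ (τ - 1 - T (c j)) * M q j * w j else 0) := by
      rw [diagonal_conjTranspose, mulVec_diagonal]
      rfl
    have h2 : (Cᴴ *ᵥ ∑ j : U, if T (c j) = τ then w j • b j else 0) q =
        ∑ j : U, if T (c j) = τ then M q j * w j else 0 := by
      rw [mulVec_sum, Finset.sum_apply]
      refine Finset.sum_congr rfl fun j _ => ?_
      split_ifs
      · rw [mulVec_smul]; simp [M, mul_comm]
      · simp
    beta_reduce
    rw [Pi.sub_apply, h1, h2, mul_sub, sub_sub, Finset.mul_sum, ← Finset.sum_add_distrib,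
      pow_succ', mul_assoc]
    congr 1
    refine Finset.sum_congr rfl fun j _ => ?_
    rcases lt_trichotomy (T (c j)) τ with h | h | h
    · rw [if_pos (by omega), if_pos h, if_neg (by omega), add_zero, ← mul_assoc, ← mul_assoc,
        ← pow_succ']
      congr 3
      omega
    · rw [if_pos (by omega), if_neg (by omega), if_pos h, mul_zero, zero_add]
      rw [show τ + 1 - 1 - T (c j) = 0 by omega, pow_zero, one_mul]
    · rw [if_neg (by omega), if_neg (by omega), if_neg (by omega), mul_zero, zero_add]
  · intro τ hu
    obtain ⟨j, -, hj⟩ := Finset.exists_ne_zero_of_sum_ne_zero hu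
    refine ⟨c j, hcn j, ?_⟩
    by_contra h
    exact hj (if_neg (fun h' => h h'.symm))
  · intro τ q
    have h1 : ‖D q ^ τ * v q‖ ≤ V * ρ ^ τ := by
      rw [norm_mul, norm_pow, hDn, mul_comm]
      exact mul_le_mul (hv _) (pow_le_pow_left₀ (norm_nonneg _) (hmax q) _) (by positivity) hV
    have h2 : ∀ j ∈ (Finset.univ : Finset U),
        ‖if T (c j) < τ then D q ^ (τ - 1 - T (c j)) * M q j * w j else 0‖ ≤
        K * (2 * ρ) * V * ρ ^ τ := by
      intro j _
      split_ifs with h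
      · rw [norm_mul, norm_mul, norm_pow, hDn]
        calc ‖d q‖ ^ (τ - 1 - T (c j)) * ‖M q j‖ * ‖w j‖
            ≤ ρ ^ (τ - 1 - T (c j)) * K * (2 * ρ * V * ρ ^ T (c j)) := by
              gcongr
              · exact hmax q
              · exact hK q j
              · exact hwb' j
          _ = K * (2 * ρ) * V * ρ ^ (τ - 1 - T (c j) + T (c j)) := by rw [pow_add]; ring
          _ ≤ K * (2 * ρ) * V * ρ ^ τ := by
              gcongr
              · exact hunst.le
              · omega
      · rw [norm_zero]; positivity
    have h3 := norm_sum_le_of_le _ h2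
    rw [Finset.sum_const, nsmul_eq_mul, Finset.card_univ] at h3
    refine (norm_sub_le _ _).trans ((add_le_add h1 h3).trans (le_of_eq ?_))
    simp only [N]
    ring
  · intro τ i
    have h2 : ∀ j ∈ (Finset.univ : Finset U),
        ‖(if T (c j) = τ then w j • b j else 0) i‖ ≤ K * (2 * ρ) * V * ρ ^ τ := by
      intro j _
      split_ifs with h
      · rw [Pi.smul_apply, smul_eq_mul, norm_mul, ← h]
        calc ‖w j‖ * ‖b j i‖ ≤ (2 * ρ * V * ρ ^ T (c j)) * K := by
              gcongr
              · exact hwb' j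
              · exact hKb j i
          _ = _ := by ring
      · rw [Pi.zero_apply, norm_zero]; positivity
    have h3 := norm_sum_le_of_le _ h2
    rw [Finset.sum_const, nsmul_eq_mul, Finset.card_univ] at h3
    beta_reduce
    rw [Finset.sum_apply]
    refine h3.trans ?_
    have : 0 ≤ V * ρ ^ τ := by positivity
    simp only [N]
    nlinarith
  · intro τ q hτ hq
    have hq0 : D q ≠ 0 := fun h => by
      rw [← hDn, h, norm_zero] at hq
      linarith
    have h1 := hwe ⟨q, hq⟩
    simp only at h1
    have h2 : D q ^ τ * v q = D q ^ (τ - 1) * (D q * v q) := by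
      rw [← mul_assoc, ← pow_succ]; congr 2; omega
    beta_reduce
    rw [h2, ← h1, Finset.mul_sum, ← Finset.sum_sub_distrib]
    refine Finset.sum_eq_zero fun j _ => ?_
    have h3 : T (c j) ≤ T n := hTm (hcn j)
    rw [if_pos (by omega), pow_sub₀ (D q) hq0 (show T (c j) ≤ τ - 1 by omega), inv_pow]
    ring

end Control


section PathBound

lemma geom_two_sided (r : ℝ) (h0 : 0 ≤ r) (h1 : r < 1) (k t : ℕ) :
    ∑ τ ∈ Finset.range k, r ^ ((t - τ) + (τ - t)) ≤ 2 / (1 - r) := by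
  have hg : ∀ N : ℕ, ∑ j ∈ Finset.range N, r ^ j ≤ 1 / (1 - r) := fun N => by
    have := (summable_geometric_of_lt_one h0 h1).sum_le_tsum (Finset.range N)
      (fun i _ => pow_nonneg h0 i)
    rw [tsum_geometric_of_lt_one h0 h1] at this
    simpa using this
  have ha : ∑ τ ∈ Finset.range k, r ^ ((t - τ) + (τ - t)) ≤
      ∑ τ ∈ Finset.range (t + k), r ^ ((t - τ) + (τ - t)) := by
    refine Finset.sum_le_sum_of_subset_of_nonneg ?_ fun i _ _ => pow_nonneg h0 _
    intro x hx
    simp only [Finset.mem_range] at *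
    omega
  refine ha.trans ?_
  rw [Finset.sum_range_add]
  have hb : ∑ τ ∈ Finset.range k, r ^ ((t - (t + τ)) + ((t + τ) - t)) ≤ 1 / (1 - r) := by
    refine le_trans (le_of_eq ?_) (hg k)
    refine Finset.sum_congr rfl fun x _ => ?_
    congr 1
    omega
  have hc : ∑ τ ∈ Finset.range t, r ^ ((t - τ) + (τ - t)) ≤ 1 / (1 - r) := by
    rw [← Finset.sum_range_reflect]
    refine le_trans (Finset.sum_le_sum fun x hx => ?_) (hg t)
    refine pow_le_pow_of_le_one h0 h1.le ?_
    have := Finset.mem_range.1 hx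
    omega
  calc _ ≤ 1 / (1 - r) + 1 / (1 - r) := add_le_add hc hb
    _ = _ := by ring

lemma cost_bound {ι κ : Type} [Fintype ι] [Fintype κ] [DecidableEq ι] [DecidableEq κ]
    (A : Matrix ι ι ℂ) (C : Matrix κ ι ℂ)
    {Q : Matrix ι ι ℂ} (hQ : Q.PosDef) {R : Matrix κ κ ℂ} (hR : R.PosDef)
    {S0 : Matrix ι ι ℂ} (hS : S0.PosSemidef) (g : ℕ → ℝ) (hg : ∀ k, g k = 0 ∨ g k = 1) (k : ℕ)
    (z : ℕ → ι → ℂ) (u : ℕ → κ → ℂ)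
    (hz : ∀ τ, τ < k → z (τ + 1) = Aᴴ *ᵥ z τ - Cᴴ *ᵥ u τ)
    (hu : ∀ τ, τ < k → g (k - 1 - τ) = 0 → u τ = 0)
    (r : ℝ) (h0 : 0 ≤ r) (h1 : r < 1) (B : ℝ) (hB : 0 ≤ B) (t : ℕ)
    (hzb : ∀ τ, τ ≤ k → ∀ i, ‖z τ i‖ ^ 2 ≤ B * r ^ ((t - τ) + (τ - t)))
    (hub : ∀ τ, τ < k → ∀ i, ‖u τ i‖ ^ 2 ≤ B * r ^ ((t - τ) + (τ - t))) :
    qf (ricc A C Q R S0 g k) (z 0) ≤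
      ((∑ i, ∑ j, ‖S0 i j‖) + ((∑ i, ∑ j, ‖R i j‖) + (∑ i, ∑ j, ‖Q i j‖)) * (2 / (1 - r))) * B := by
  refine (qf_ricc_le A C hQ hR hS g hg k z u hz hu).trans ?_
  set SS := ∑ i, ∑ j, ‖S0 i j‖ with hSS
  set SR := ∑ i, ∑ j, ‖R i j‖ with hSR
  set SQ := ∑ i, ∑ j, ‖Q i j‖ with hSQ
  have hSS0 : 0 ≤ SS := Finset.sum_nonneg fun i _ => Finset.sum_nonneg fun j _ => norm_nonneg _
  have hSR0 : 0 ≤ SR := Finset.sum_nonneg fun i _ => Finset.sum_nonneg fun j _ => norm_nonneg _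
  have hSQ0 : 0 ≤ SQ := Finset.sum_nonneg fun i _ => Finset.sum_nonneg fun j _ => norm_nonneg _
  have a1 : qf S0 (z k) ≤ SS * B := by
    refine qf_le S0 (z k) B fun i => (hzb k le_rfl i).trans ?_
    exact mul_le_of_le_one_right hB (pow_le_one₀ h0 h1.le)
  have a2 : ∑ τ ∈ Finset.range k, (qf R (u τ) + qf Q (z τ)) ≤
      ∑ τ ∈ Finset.range k, (SR + SQ) * B * r ^ ((t - τ) + (τ - t)) := by
    refine Finset.sum_le_sum fun τ hτ => ?_
    have hτ := Finset.mem_range.1 hτ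
    have b1 := qf_le R (u τ) _ (hub τ hτ)
    have b2 := qf_le Q (z τ) _ (hzb τ hτ.le)
    rw [← hSR] at b1
    rw [← hSQ] at b2
    calc _ ≤ _ := add_le_add b1 b2
      _ = _ := by ring
  rw [← Finset.mul_sum] at a2
  have a3 := mul_le_mul_of_nonneg_left (geom_two_sided r h0 h1 k t)
    (show 0 ≤ (SR + SQ) * B by positivity)
  calc _ ≤ SS * B + (SR + SQ) * B * (2 / (1 - r)) := add_le_add a1 (a2.trans a3)
    _ = _ := by ring

lemma exists_rate {n : ℕ} (d : Fin (n + 1) → ℂ) (hunst : 1 < ‖d 0‖) :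
    ∃ r : ℝ, 0 ≤ r ∧ r < 1 ∧ 1 ≤ ‖d 0‖ ^ 2 * r ∧ ∀ q, ‖d q‖ < 1 → ‖d q‖ ^ 2 ≤ r := by
  have e1 : ∀ᶠ r : ℝ in nhdsWithin 1 (Set.Iio 1), (‖d 0‖ ^ 2)⁻¹ < r := by
    refine nhdsWithin_le_nhds (lt_mem_nhds ?_)
    exact inv_lt_one_of_one_lt₀ (by nlinarith)
  have e2 : ∀ᶠ r : ℝ in nhdsWithin 1 (Set.Iio 1), ∀ q, ‖d q‖ < 1 → ‖d q‖ ^ 2 ≤ r := by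
    refine Filter.eventually_all.2 fun q => ?_
    by_cases h : ‖d q‖ < 1
    · have : ‖d q‖ ^ 2 < 1 := by nlinarith [norm_nonneg (d q)]
      filter_upwards [nhdsWithin_le_nhds (lt_mem_nhds this)] with r hr _
      exact le_of_lt hr
    · exact Filter.Eventually.of_forall fun r h' => absurd h' h
  obtain ⟨r, ⟨h1, h2⟩, h3⟩ := ((e1.and e2).and self_mem_nhdsWithin).exists
  have hp : 0 < ‖d 0‖ ^ 2 := by positivity
  refine ⟨r, le_trans (by positivity) h1.le, h3, ?_, h2⟩
  have := mul_lt_mul_of_pos_left h1 hp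
  rw [mul_inv_cancel₀ hp.ne'] at this
  exact this.le

lemma path_bound {n m : ℕ} (d : Fin (n + 1) → ℂ) (C : Matrix (Fin m) (Fin (n + 1)) ℂ)
    (hmax : ∀ j, ‖d j‖ ≤ ‖d 0‖)
    (hunst : 1 < ‖d 0‖)
    (hnd : ∀ r : ℝ, 1 ≤ r → LinearIndependent ℂ
      (fun j : {j : Fin (n + 1) // ‖d j‖ = r} => fun i : Fin m => C i j.1))
    {Q : Matrix (Fin (n + 1)) (Fin (n + 1)) ℂ} (hQ : Q.PosDef)
    {R : Matrix (Fin m) (Fin m) ℂ} (hR : R.PosDef)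
    {S0 : Matrix (Fin (n + 1)) (Fin (n + 1)) ℂ} (hS : S0.PosSemidef) :
    ∃ (K : ℝ) (N : ℕ), 0 ≤ K ∧ ∀ g : ℕ → ℝ, (∀ k, g k = 0 ∨ g k = 1) → ∀ k, ∃ t, t ≤ k ∧
      ((Finset.range t).filter (fun τ => g (k - 1 - τ) = 1)).card ≤ N ∧
      ∀ v, qf (ricc (Matrix.diagonal d) C Q R S0 g k) v ≤
        K * (‖d 0‖ ^ 2) ^ t * ∑ i, ‖v i‖ ^ 2 := by
  classical
  obtain ⟨L, K, hL, hK, hctrl⟩ := ctrl_exists d C hmax hunst hnd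
  obtain ⟨r, hr0, hr1, hrρ, hrd⟩ := exists_rate d hunst
  set ρ := ‖d 0‖ with hρ
  have hρ0 : 0 < ρ := by linarith
  set c0 := (∑ i, ∑ j, ‖S0 i j‖) +
    ((∑ i, ∑ j, ‖R i j‖) + (∑ i, ∑ j, ‖Q i j‖)) * (2 / (1 - r)) with hc0
  have h1r : 0 < 1 - r := by linarith
  have hc00 : 0 ≤ c0 := by
    have e1 : 0 ≤ ∑ i, ∑ j, ‖S0 i j‖ := Finset.sum_nonneg fun i _ => Finset.sum_nonneg fun j _ => norm_nonneg _
    have e2 : 0 ≤ ∑ i, ∑ j, ‖R i j‖ := Finset.sum_nonneg fun i _ => Finset.sum_nonneg fun j _ => norm_nonneg _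
    have e3 : 0 ≤ ∑ i, ∑ j, ‖Q i j‖ := Finset.sum_nonneg fun i _ => Finset.sum_nonneg fun j _ => norm_nonneg _
    positivity
  have hpow : ∀ τ t : ℕ, τ ≤ t → (ρ ^ 2) ^ τ ≤ (ρ ^ 2) ^ t * r ^ (t - τ) := fun τ t h => by
    obtain ⟨s, rfl⟩ := Nat.exists_eq_add_of_le h
    rw [Nat.add_sub_cancel_left, pow_add, mul_assoc, ← mul_pow]
    exact le_mul_of_one_le_right (by positivity) (one_le_pow₀ hrρ)
  refine ⟨c0 * (K ^ 2 + 1), (n + 1) * L, by positivity, fun g hg k => ?_⟩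
  set P : ℕ → Prop := fun τ => k ≤ τ ∨ g (k - 1 - τ) = 1 with hP
  have hPinf : {τ | P τ}.Infinite := by
    refine Set.infinite_of_not_bddAbove fun ⟨b, hb⟩ => ?_
    have := hb (show P (k + b + 1) from Or.inl (by omega))
    omega
  set T : ℕ → ℕ := fun l => Nat.nth P (l * L + (L - 1)) with hT
  have hmono : StrictMono (Nat.nth P) := Nat.nth_strictMono hPinf
  have hgap : ∀ l, T l + L ≤ T (l + 1) := fun l => by
    have e : (l + 1) * L + (L - 1) = (l * L + (L - 1)) + L := by ring
    simp only [hT]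
    rw [e]
    have := hmono.add_le_nat L (l * L + (L - 1))
    rw [add_comm L (l * L + (L - 1))] at this
    omega
  have hmem : ∀ l, P (T l) := fun l => Nat.nth_mem_of_infinite hPinf _
  have hTm : StrictMono T := strictMono_nat_of_lt_succ fun l => by have := hgap l; omega
  have hcount : Nat.count P (T n) = n * L + (L - 1) := Nat.count_nth_of_infinite hPinf _
  have hcard : ∀ t, t ≤ T n + 1 → t ≤ k →
      ((Finset.range t).filter (fun τ => g (k - 1 - τ) = 1)).card ≤ (n + 1) * L := by
    intro t h1 h2
    have e1 : ((Finset.range t).filter (fun τ => g (k - 1 - τ) = 1)).card ≤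
        Nat.count P (T n + 1) := by
      rw [Nat.count_eq_card_filter_range]
      refine Finset.card_le_card fun x hx => ?_
      simp only [Finset.mem_filter, Finset.mem_range] at hx ⊢
      exact ⟨by omega, Or.inr hx.2⟩
    rw [Nat.count_succ, hcount, if_pos (hmem n)] at e1
    have e2 : (n + 1) * L = n * L + L := by ring
    omega
  by_cases hk : T n < k
  · refine ⟨T n + 1, hk, hcard _ le_rfl hk, fun v => ?_⟩
    set V2 := ∑ i, ‖v i‖ ^ 2 with hV2
    have hV20 : 0 ≤ V2 := Finset.sum_nonneg fun i _ => by positivity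
    have hvV : ∀ i, ‖v i‖ ≤ Real.sqrt V2 := fun i => by
      refine Real.le_sqrt_of_sq_le ?_
      exact Finset.single_le_sum (f := fun i => ‖v i‖ ^ 2) (fun i _ => by positivity)
        (Finset.mem_univ i)
    obtain ⟨z, u, hz0, hz, hu, hzb, hub, hzu⟩ := hctrl T hgap v (Real.sqrt V2)
      (Real.sqrt_nonneg _) hvV
    set B := (K ^ 2 + 1) * V2 * (ρ ^ 2) ^ (T n + 1) with hB
    have hB0 : 0 ≤ B := by positivity
    have huz : ∀ τ, T n < τ → u τ = 0 := fun τ h => by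
      by_contra hne
      obtain ⟨l, hl, rfl⟩ := hu τ hne
      have := hTm.monotone hl
      omega
    have hsmall : ∀ (x : ℂ) (τ : ℕ), τ ≤ T n + 1 → ‖x‖ ≤ K * Real.sqrt V2 * ρ ^ τ →
        ‖x‖ ^ 2 ≤ B * r ^ ((T n + 1 - τ) + (τ - (T n + 1))) := fun x τ h hx => by
      have e0 : τ - (T n + 1) = 0 := by omega
      rw [e0, add_zero]
      calc ‖x‖ ^ 2 ≤ (K * Real.sqrt V2 * ρ ^ τ) ^ 2 := by gcongr
        _ = K ^ 2 * V2 * (ρ ^ 2) ^ τ := by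
          rw [mul_pow, mul_pow, Real.sq_sqrt hV20, ← pow_mul, ← pow_mul, mul_comm τ]
        _ ≤ (K ^ 2 + 1) * V2 * ((ρ ^ 2) ^ (T n + 1) * r ^ (T n + 1 - τ)) := by
          gcongr
          · linarith
          · exact hpow _ _ h
        _ = _ := by rw [hB]; ring
    have hlarge : ∀ s i, ‖z (T n + 1 + s) i‖ ^ 2 ≤ B * r ^ s := by
      intro s
      induction s with
      | zero =>
        intro i
        have := hsmall _ _ le_rfl (hzb (T n + 1) i)
        simpa using this
      | succ s ih =>
        intro i
        by_cases hi : 1 ≤ ‖d i‖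
        · rw [hzu _ i (by omega) hi]
          rw [norm_zero, zero_pow two_ne_zero]
          positivity
        · push Not at hi
          rw [← add_assoc, hz, huz _ (by omega), mulVec_zero, sub_zero, diagonal_conjTranspose,
            mulVec_diagonal, norm_mul, mul_pow, Pi.star_apply, norm_star]
          calc _ ≤ r * (B * r ^ s) :=
              mul_le_mul (hrd i hi) (ih i) (by positivity) hr0
            _ = _ := by ring
    have := cost_bound (Matrix.diagonal d) C hQ hR hS g hg k z u (fun τ _ => hz τ)
      (fun τ hτ h => by
        by_contra hne
        obtain ⟨l, hl, rfl⟩ := hu τ hne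
        rcases hmem l with h' | h'
        · omega
        · rw [h] at h'; norm_num at h')
      r hr0 hr1 B hB0 (T n + 1)
      (fun τ _ i => by
        rcases le_total τ (T n + 1) with h | h
        · exact hsmall _ _ h (hzb τ i)
        · obtain ⟨s, rfl⟩ := Nat.exists_eq_add_of_le h
          have := hlarge s i
          have e0 : (T n + 1 - (T n + 1 + s)) + (T n + 1 + s - (T n + 1)) = s := by omega
          rwa [e0])
      (fun τ _ i => by
        rcases le_or_gt τ (T n) with h | h
        · exact hsmall _ _ (by omega) (hub τ i)
        · rw [huz τ h]
          rw [Pi.zero_apply, norm_zero, zero_pow two_ne_zero]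
          positivity)
    rw [hz0, ← hc0] at this
    calc _ ≤ _ := this
      _ = _ := by rw [hB]; ring
  · push Not at hk
    refine ⟨k, le_rfl, hcard _ (by omega) le_rfl, fun v => ?_⟩
    set V2 := ∑ i, ‖v i‖ ^ 2 with hV2
    have hV20 : 0 ≤ V2 := Finset.sum_nonneg fun i _ => by positivity
    have hvV : ∀ i, ‖v i‖ ^ 2 ≤ V2 := fun i =>
      Finset.single_le_sum (f := fun i => ‖v i‖ ^ 2) (fun i _ => by positivity)
        (Finset.mem_univ i)
    set B := (K ^ 2 + 1) * V2 * (ρ ^ 2) ^ k with hB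
    have hB0 : 0 ≤ B := by positivity
    have := cost_bound (Matrix.diagonal d) C hQ hR hS g hg k
      (fun τ i => (star (d i)) ^ τ * v i) (fun _ => 0)
      (fun τ _ => by
        ext i
        rw [mulVec_zero, sub_zero, diagonal_conjTranspose, mulVec_diagonal, Pi.star_apply]
        ring)
      (fun τ _ _ => rfl)
      r hr0 hr1 B hB0 k
      (fun τ hτ i => by
        have e0 : τ - k = 0 := by omega
        rw [e0, add_zero, norm_mul, norm_pow, norm_star, mul_pow, ← pow_mul, mul_comm τ, pow_mul]
        calc (‖d i‖ ^ 2) ^ τ * ‖v i‖ ^ 2 ≤ ((ρ ^ 2) ^ k * r ^ (k - τ)) * V2 := by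
              refine mul_le_mul (le_trans ?_ (hpow _ _ hτ)) (hvV i) (by positivity) (by positivity)
              have := hmax i
              gcongr
          _ ≤ (K ^ 2 + 1) * (((ρ ^ 2) ^ k * r ^ (k - τ)) * V2) :=
              le_mul_of_one_le_left (by positivity) (by nlinarith)
          _ = _ := by rw [hB]; ring)
      (fun τ _ i => by
        rw [Pi.zero_apply, norm_zero, zero_pow two_ne_zero]
        positivity)
    rw [← hc0] at this
    simp only [pow_zero, one_mul] at this
    calc _ ≤ _ := this
      _ = _ := by rw [hB]; ring

end PathBound

section Prob

lemma ricc_integrable {ι κ Ω : Type} [Fintype ι] [Fintype κ] [DecidableEq ι] [DecidableEq κ]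
    (A : Matrix ι ι ℂ) (C : Matrix κ ι ℂ) (Q : Matrix ι ι ℂ) (R : Matrix κ κ ℂ)
    (S0 : Matrix ι ι ℂ) [MeasurableSpace Ω] (μ : Measure Ω) [IsProbabilityMeasure μ]
    (γ : ℕ → Ω → ℝ) (hmeas : ∀ k, Measurable (γ k)) (h01 : ∀ k ω, γ k ω = 0 ∨ γ k ω = 1)
    (k : ℕ) (i j : ι) :
    Integrable (fun ω => ricc A C Q R S0 (fun l => γ l ω) k i j) μ := by
  have hm : ∀ k, ∀ s : Set (Matrix ι ι ℂ),
      MeasurableSet ((fun ω => ricc A C Q R S0 (fun l => γ l ω) k) ⁻¹' s) := by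
    intro k
    induction k with
    | zero => intro s; exact MeasurableSet.const (S0 ∈ s)
    | succ k ih =>
      intro s
      have e : ((fun ω => ricc A C Q R S0 (fun l => γ l ω) (k + 1)) ⁻¹' s) =
          (γ k ⁻¹' {0} ∩ (fun ω => ricc A C Q R S0 (fun l => γ l ω) k) ⁻¹'
            (riccStep A C Q R 0 ⁻¹' s)) ∪
          (γ k ⁻¹' {1} ∩ (fun ω => ricc A C Q R S0 (fun l => γ l ω) k) ⁻¹'
            (riccStep A C Q R 1 ⁻¹' s)) := by
        ext ω
        simp only [Set.mem_preimage, Set.mem_union, Set.mem_inter_iff, Set.mem_singleton_iff, ricc]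
        rcases h01 k ω with h | h <;> simp [h]
      rw [e]
      exact ((hmeas k (measurableSet_singleton 0)).inter (ih _)).union
        ((hmeas k (measurableSet_singleton 1)).inter (ih _))
  have hb : ∀ k, ∃ F : Finset (Matrix ι ι ℂ), ∀ ω, ricc A C Q R S0 (fun l => γ l ω) k ∈ F := by
    classical
    intro k
    induction k with
    | zero => exact ⟨{S0}, fun ω => by simp [ricc]⟩
    | succ k ih =>
      obtain ⟨F, hF⟩ := ih
      refine ⟨F.image (riccStep A C Q R 0) ∪ F.image (riccStep A C Q R 1), fun ω => ?_⟩
      rw [Finset.mem_union]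
      simp only [ricc]
      rcases h01 k ω with h | h
      · rw [h]; exact Or.inl (Finset.mem_image_of_mem _ (hF ω))
      · rw [h]; exact Or.inr (Finset.mem_image_of_mem _ (hF ω))
  obtain ⟨F, hF⟩ := hb k
  have hmm : Measurable (fun ω => ricc A C Q R S0 (fun l => γ l ω) k i j) := fun s _ =>
    hm k {X | X i j ∈ s}
  refine Integrable.of_bound hmm.aestronglyMeasurable (∑ X ∈ F, ‖X i j‖)
    (Filter.Eventually.of_forall fun ω => ?_)
  exact Finset.single_le_sum (f := fun X : Matrix ι ι ℂ => ‖X i j‖)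
    (fun X _ => norm_nonneg _) (hF ω)

lemma integral_gamma {Ω : Type} [MeasurableSpace Ω] (μ : Measure Ω) [IsProbabilityMeasure μ]
    (γ : Ω → ℝ) (p : ℝ) (hp : 0 ≤ p) (hmeas : Measurable γ)
    (h01 : ∀ ω, γ ω = 0 ∨ γ ω = 1) (hber : μ {ω | γ ω = 1} = ENNReal.ofReal p) :
    ∫ ω, γ ω ∂μ = p := by
  have e : γ = Set.indicator {ω | γ ω = 1} (fun _ => (1 : ℝ)) := by
    ext ω
    rcases h01 ω with h | h <;> simp [Set.indicator, h]
  have hms : MeasurableSet {ω | γ ω = 1} := hmeas (measurableSet_singleton 1)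
  rw [e, integral_indicator_const _ hms, Measure.real, hber, ENNReal.toReal_ofReal hp]
  simp

lemma gamma_integrable {Ω : Type} [MeasurableSpace Ω] (μ : Measure Ω) [IsProbabilityMeasure μ]
    (γ : Ω → ℝ) (hmeas : Measurable γ)
    (h01 : ∀ ω, γ ω = 0 ∨ γ ω = 1) : Integrable γ μ := by
  refine Integrable.of_bound hmeas.aestronglyMeasurable 1 (Filter.Eventually.of_forall fun ω => ?_)
  rcases h01 ω with h | h <;> simp [h]

lemma integral_prod_gamma {Ω : Type} [MeasurableSpace Ω] (μ : Measure Ω) [IsProbabilityMeasure μ]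
    (γ : ℕ → Ω → ℝ) (p : ℝ) (hp : 0 ≤ p) (hmeas : ∀ k, Measurable (γ k)) (hind : iIndepFun γ μ)
    (h01 : ∀ k ω, γ k ω = 0 ∨ γ k ω = 1) (hber : ∀ k, μ {ω | γ k ω = 1} = ENNReal.ofReal p)
    (x : ℝ) (k s : ℕ) (hs : s ≤ k) :
    ∫ ω, ∏ τ ∈ Finset.range s, (1 - (1 - x) * γ (k - 1 - τ) ω) ∂μ = (1 - (1 - x) * p) ^ s := by
  have hinj : Function.Injective (fun τ : Fin s => k - 1 - (τ : ℕ)) := by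
    intro a b h
    have := a.2
    have := b.2
    simp only at h
    ext
    omega
  have h1 := hind.precomp hinj
  have h2 := h1.integral_fun_prod_comp (f := fun _ y => 1 - (1 - x) * y)
    (fun i => (hmeas _).aemeasurable)
    (fun i => (by fun_prop : Measurable fun y : ℝ => 1 - (1 - x) * y).aestronglyMeasurable)
  have h3 : ∀ l, ∫ ω, (1 - (1 - x) * γ l ω) ∂μ = 1 - (1 - x) * p := fun l => by
    rw [integral_sub (integrable_const _) ((gamma_integrable μ _ (hmeas l) (h01 l)).const_mul _),
      integral_const_mul, integral_gamma μ _ p hp (hmeas l) (h01 l) (hber l)]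
    simp
  simp only [h3, Finset.prod_const, Finset.card_univ, Fintype.card_fin] at h2
  rw [← h2]
  congr 1
  ext ω
  rw [Finset.prod_range]

lemma prod_integrable {Ω : Type} [MeasurableSpace Ω] (μ : Measure Ω) [IsProbabilityMeasure μ]
    (γ : ℕ → Ω → ℝ) (hmeas : ∀ k, Measurable (γ k))
    (h01 : ∀ k ω, γ k ω = 0 ∨ γ k ω = 1)
    (x : ℝ) (hx0 : 0 ≤ x) (hx1 : x ≤ 1) (k s : ℕ) :
    Integrable (fun ω => ∏ τ ∈ Finset.range s, (1 - (1 - x) * γ (k - 1 - τ) ω)) μ := by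
  have hme : Measurable (fun ω => ∏ τ ∈ Finset.range s, (1 - (1 - x) * γ (k - 1 - τ) ω)) :=
    Finset.measurable_fun_prod _ fun τ _ => ((hmeas _).const_mul _).const_sub _
  refine Integrable.of_bound hme.aestronglyMeasurable 1 (Filter.Eventually.of_forall fun ω => ?_)
  rw [norm_prod]
  refine Finset.prod_le_one (fun _ _ => norm_nonneg _) fun τ _ => ?_
  rcases h01 (k - 1 - τ) ω with h | h
  · simp [h]
  · rw [h, Real.norm_eq_abs, abs_le]; constructor <;> linarith

lemma path_le (g : ℕ → ℝ) (hg : ∀ k, g k = 0 ∨ g k = 1) (ρ2 : ℝ) (hρ : 0 ≤ ρ2)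
    (x : ℝ) (hx0 : 0 < x) (hx1 : x ≤ 1) (k t N : ℕ) (ht : t ≤ k)
    (hN : ((Finset.range t).filter (fun τ => g (k - 1 - τ) = 1)).card ≤ N) :
    ρ2 ^ t ≤ (x ^ N)⁻¹ * ∑ s ∈ Finset.range (k + 1), ρ2 ^ s *
      ∏ τ ∈ Finset.range s, (1 - (1 - x) * g (k - 1 - τ)) := by
  have hf : ∀ l, 1 - (1 - x) * g l = if g l = 1 then x else 1 := fun l => by
    rcases hg l with h | h <;> simp [h]
  have hp : ∏ τ ∈ Finset.range t, (1 - (1 - x) * g (k - 1 - τ)) =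
      x ^ ((Finset.range t).filter (fun τ => g (k - 1 - τ) = 1)).card := by
    simp only [hf]
    rw [Finset.prod_ite]
    simp
  have hnn : ∀ s, 0 ≤ ∏ τ ∈ Finset.range s, (1 - (1 - x) * g (k - 1 - τ)) := fun s => by
    refine Finset.prod_nonneg fun τ _ => ?_
    rw [hf]; split_ifs <;> linarith
  have h1 : ρ2 ^ t * ∏ τ ∈ Finset.range t, (1 - (1 - x) * g (k - 1 - τ)) ≤
      ∑ s ∈ Finset.range (k + 1), ρ2 ^ s *
      ∏ τ ∈ Finset.range s, (1 - (1 - x) * g (k - 1 - τ)) :=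
    Finset.single_le_sum (f := fun s => ρ2 ^ s *
      ∏ τ ∈ Finset.range s, (1 - (1 - x) * g (k - 1 - τ)))
      (fun s _ => mul_nonneg (pow_nonneg hρ _) (hnn s)) (Finset.mem_range.2 (by omega))
  rw [inv_mul_eq_div, le_div_iff₀ (by positivity)]
  refine le_trans ?_ h1
  rw [hp]
  exact mul_le_mul_of_nonneg_left (pow_le_pow_of_le_one hx0.le hx1 hN) (pow_nonneg hρ _)

lemma qf_matExp {ι Ω : Type} [Fintype ι] [DecidableEq ι] [MeasurableSpace Ω] (μ : Measure Ω)
    (P : Ω → Matrix ι ι ℂ) (hP : ∀ i j, Integrable (fun ω => P ω i j) μ) (v : ι → ℂ) :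
    qf (matExp μ P) v = ∫ ω, qf (P ω) v ∂μ ∧ Integrable (fun ω => qf (P ω) v) μ := by
  have hI : Integrable (fun ω => star v ⬝ᵥ (P ω *ᵥ v)) μ := by
    simp only [dotProduct, mulVec]
    exact integrable_finsetSum _ fun i _ => (integrable_finsetSum _ fun j _ =>
      (hP i j).mul_const _).const_mul _
  refine ⟨?_, hI.re⟩
  have e : star v ⬝ᵥ (matExp μ P *ᵥ v) = ∫ ω, star v ⬝ᵥ (P ω *ᵥ v) ∂μ := by
    simp only [dotProduct, mulVec, matExp, of_apply]
    rw [integral_finsetSum _ fun i _ => (integrable_finsetSum _ fun j _ =>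
      (hP i j).mul_const _).const_mul _]
    refine Finset.sum_congr rfl fun i _ => ?_
    rw [integral_const_mul, integral_finsetSum _ fun j _ => (hP i j).mul_const _]
    congr 1
    refine Finset.sum_congr rfl fun j _ => ?_
    rw [integral_mul_const]
  unfold qf
  rw [e]
  exact (integral_re hI).symm

lemma matExp_herm {ι Ω : Type} [MeasurableSpace Ω] (μ : Measure Ω)
    (P : Ω → Matrix ι ι ℂ) (hP : ∀ ω, (P ω).IsHermitian) : (matExp μ P).IsHermitian := by
  ext i j
  simp only [conjTranspose_apply, matExp, of_apply]
  rw [Complex.star_def, ← integral_conj]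
  congr 1
  ext ω
  exact (hP ω).apply i j

lemma qf_smul_one {ι : Type} [Fintype ι] [DecidableEq ι] (c : ℝ) (v : ι → ℂ) :
    qf ((c : ℂ) • (1 : Matrix ι ι ℂ)) v = c * ∑ i, ‖v i‖ ^ 2 := by
  unfold qf
  rw [smul_mulVec, one_mulVec, dotProduct_smul, dotProduct, smul_eq_mul, Complex.re_ofReal_mul,
    Complex.re_sum]
  congr 1
  refine Finset.sum_congr rfl fun i _ => ?_
  rw [Pi.star_apply, Complex.star_def, ← Complex.normSq_eq_conj_mul_self, Complex.ofReal_re,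
    Complex.normSq_eq_norm_sq]

lemma psd_of_qf {ι : Type} [Fintype ι] [DecidableEq ι] (X : Matrix ι ι ℂ) (hX : X.IsHermitian)
    (h : ∀ v, 0 ≤ qf X v) : X.PosSemidef := by
  refine Matrix.PosSemidef.of_dotProduct_mulVec_nonneg hX fun v => ?_
  rw [Complex.le_def]
  exact ⟨h v, (hX.im_star_dotProduct_mulVec_self v).symm⟩

end Prob

section Final

lemma upper_bound {n m : ℕ} (d : Fin (n + 1) → ℂ) (C : Matrix (Fin m) (Fin (n + 1)) ℂ)
    (hmax : ∀ j, ‖d j‖ ≤ ‖d 0‖)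
    (hunst : 1 < ‖d 0‖)
    (hnd : ∀ r : ℝ, 1 ≤ r → LinearIndependent ℂ
      (fun j : {j : Fin (n + 1) // ‖d j‖ = r} => fun i : Fin m => C i j.1))
    (Q : Matrix (Fin (n + 1)) (Fin (n + 1)) ℂ) (R : Matrix (Fin m) (Fin m) ℂ)
    (hQ : Q.PosDef) (hR : R.PosDef)
    {Ω : Type} [MeasurableSpace Ω] (μ : Measure Ω) [IsProbabilityMeasure μ]
    (γ : ℕ → Ω → ℝ) (p : ℝ)
    (hmeas : ∀ k, Measurable (γ k))
    (hind : iIndepFun γ μ)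
    (h01 : ∀ k ω, γ k ω = 0 ∨ γ k ω = 1)
    (hber : ∀ k, μ {ω | γ k ω = 1} = ENNReal.ofReal p)
    (hp : 1 - (‖d 0‖ ^ 2)⁻¹ < p)
    (S0 : Matrix (Fin (n + 1)) (Fin (n + 1)) ℂ) (hS : S0.PosSemidef) :
    EBounded μ (fun k ω => ricc (Matrix.diagonal d) C Q R S0 (fun i => γ i ω) k) := by
  have hint := ricc_integrable (Matrix.diagonal d) C Q R S0 μ γ hmeas h01
  refine ⟨hint, ?_⟩
  obtain ⟨K, N, hK, hpath⟩ := path_bound d C hmax hunst hnd hQ hR hS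
  set ρ2 := ‖d 0‖ ^ 2 with hρ2
  have hρ1 : 1 < ρ2 := by rw [hρ2]; nlinarith
  have hp0 : 0 ≤ p := by
    have := inv_lt_one_of_one_lt₀ hρ1
    linarith
  have hp1 : p ≤ 1 := by
    have : μ {ω | γ 0 ω = 1} ≤ 1 := prob_le_one
    rw [hber] at this
    exact ENNReal.ofReal_le_one.1 this
  have hlt : ρ2 * (1 - p) < 1 := by
    have h1 : 1 - p < ρ2⁻¹ := by linarith
    have := mul_lt_mul_of_pos_left h1 (show 0 < ρ2 by linarith)
    rwa [mul_inv_cancel₀ (by linarith)] at this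
  set e := 1 - ρ2 * (1 - p) with he
  have he0 : 0 < e := by linarith
  have he1 : e ≤ 1 := by nlinarith
  set x := e / (2 * ρ2) with hx
  have hx0 : 0 < x := by positivity
  have hxe : ρ2 * x = e / 2 := by rw [hx]; field_simp
  have hx1 : x ≤ 1 := by nlinarith
  set β := ρ2 * (1 - (1 - x) * p) with hβ
  have hβ0 : 0 ≤ β := by
    have : (1 - x) * p ≤ 1 := by nlinarith
    have : 0 ≤ 1 - (1 - x) * p := by linarith
    positivity
  have hβ1 : β < 1 := by
    have : β = (1 - e) + p * (ρ2 * x) := by rw [hβ, he]; ring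
    rw [this, hxe]
    nlinarith
  set c := K * ((x ^ N)⁻¹ * (1 / (1 - β))) with hc
  have hsum : ∀ k : ℕ, Integrable (fun ω => ∑ s ∈ Finset.range (k + 1), ρ2 ^ s *
      ∏ τ ∈ Finset.range s, (1 - (1 - x) * γ (k - 1 - τ) ω)) μ := fun k =>
    integrable_finsetSum _ fun s _ => (prod_integrable μ γ hmeas h01 x hx0.le hx1 k s).const_mul _
  have hsumv : ∀ k : ℕ, ∫ ω, (∑ s ∈ Finset.range (k + 1), ρ2 ^ s *
      ∏ τ ∈ Finset.range s, (1 - (1 - x) * γ (k - 1 - τ) ω)) ∂μ ≤ 1 / (1 - β) := fun k => by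
    rw [integral_finsetSum _ fun s _ =>
      (prod_integrable μ γ hmeas h01 x hx0.le hx1 k s).const_mul _]
    have e1 : ∀ s ∈ Finset.range (k + 1), ∫ ω, (ρ2 ^ s *
      ∏ τ ∈ Finset.range s, (1 - (1 - x) * γ (k - 1 - τ) ω)) ∂μ = β ^ s := fun s hs => by
      rw [integral_const_mul, integral_prod_gamma μ γ p hp0 hmeas hind h01 hber x k s
        (by have := Finset.mem_range.1 hs; omega), ← mul_pow]
    rw [Finset.sum_congr rfl e1]
    have := (summable_geometric_of_lt_one hβ0 hβ1).sum_le_tsum (Finset.range (k + 1))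
      (fun i _ => pow_nonneg hβ0 i)
    rw [tsum_geometric_of_lt_one hβ0 hβ1] at this
    simpa using this
  have hMh : ((c : ℂ) • (1 : Matrix (Fin (n + 1)) (Fin (n + 1)) ℂ)).IsHermitian := by
    unfold Matrix.IsHermitian
    rw [conjTranspose_smul, conjTranspose_one, Complex.star_def, Complex.conj_ofReal]
  refine ⟨(c : ℂ) • 1, hMh, fun k => ?_⟩
  have hPsd : ∀ ω, (ricc (Matrix.diagonal d) C Q R S0 (fun i => γ i ω) k).PosSemidef := fun ω =>
    ricc_psd _ C hQ hR hS _ (fun k => h01 k ω) k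
  refine psd_of_qf _ (hMh.sub (matExp_herm μ _ fun ω => (hPsd ω).isHermitian)) fun v => ?_
  obtain ⟨q1, q2⟩ := qf_matExp μ (fun ω => ricc (Matrix.diagonal d) C Q R S0 (fun i => γ i ω) k)
    (hint k) v
  have hsub : qf ((c : ℂ) • 1 - matExp μ
      (fun ω => ricc (Matrix.diagonal d) C Q R S0 (fun i => γ i ω) k)) v =
      c * ∑ i, ‖v i‖ ^ 2 - qf (matExp μ
      (fun ω => ricc (Matrix.diagonal d) C Q R S0 (fun i => γ i ω) k)) v := by
    rw [← qf_smul_one]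
    unfold qf
    rw [sub_mulVec, dotProduct_sub, Complex.sub_re]
  rw [hsub, q1, sub_nonneg]
  set V2 := ∑ i, ‖v i‖ ^ 2 with hV2
  have hV20 : 0 ≤ V2 := Finset.sum_nonneg fun i _ => by positivity
  have hle : ∀ ω, qf (ricc (Matrix.diagonal d) C Q R S0 (fun i => γ i ω) k) v ≤
      K * (x ^ N)⁻¹ * V2 * (∑ s ∈ Finset.range (k + 1), ρ2 ^ s *
      ∏ τ ∈ Finset.range s, (1 - (1 - x) * γ (k - 1 - τ) ω)) := fun ω => by
    obtain ⟨t, ht, hN, hb⟩ := hpath (fun i => γ i ω) (fun k => h01 k ω) k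
    refine (hb v).trans ?_
    have := path_le (fun i => γ i ω) (fun k => h01 k ω) ρ2 (by linarith) x hx0 hx1 k t N ht hN
    have h2 := mul_le_mul_of_nonneg_left this (show 0 ≤ K * V2 by positivity)
    calc K * ρ2 ^ t * V2 = K * V2 * ρ2 ^ t := by ring
      _ ≤ _ := h2
      _ = _ := by ring
  calc ∫ ω, qf (ricc (Matrix.diagonal d) C Q R S0 (fun i => γ i ω) k) v ∂μ ≤ _ :=
      integral_mono q2 ((hsum k).const_mul _) hle
    _ = K * (x ^ N)⁻¹ * V2 * _ := integral_const_mul _ _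
    _ ≤ K * (x ^ N)⁻¹ * V2 * (1 / (1 - β)) :=
      mul_le_mul_of_nonneg_left (hsumv k) (by positivity)
    _ = c * V2 := by rw [hc]; ring

lemma ricc_entry_ge {n m : ℕ} (d : Fin (n + 1) → ℂ) (C : Matrix (Fin m) (Fin (n + 1)) ℂ)
    (Q : Matrix (Fin (n + 1)) (Fin (n + 1)) ℂ) (R : Matrix (Fin m) (Fin m) ℂ)
    (hQ : Q.PosDef) (g : ℕ → ℝ) (k : ℕ) (hg : ∀ i, i < k → g i = 0) :
    (‖d 0‖ ^ 2) ^ k ≤ (ricc (Matrix.diagonal d) C Q R 1 g k 0 0).re := by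
  induction k with
  | zero => simp [ricc]
  | succ k ih =>
    have h1 := ih fun i hi => hg i (by omega)
    have h2 : 0 ≤ (Q 0 0).re := (Complex.le_def.1 hQ.posSemidef.diag_nonneg).1
    have h3 : (Matrix.diagonal d * ricc (Matrix.diagonal d) C Q R 1 g k * (Matrix.diagonal d)ᴴ) 0 0
        = ((‖d 0‖ ^ 2 : ℝ) : ℂ) * ricc (Matrix.diagonal d) C Q R 1 g k 0 0 := by
      rw [diagonal_conjTranspose, mul_diagonal, diagonal_mul, Pi.star_apply, Complex.star_def,
        mul_right_comm, Complex.mul_conj, Complex.normSq_eq_norm_sq]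
    simp only [ricc]
    rw [hg k (by omega), riccStep_zero_eq, Matrix.add_apply, h3, Complex.add_re,
      Complex.re_ofReal_mul, pow_succ']
    have := mul_le_mul_of_nonneg_left h1 (sq_nonneg ‖d 0‖)
    linarith

lemma lower_bound {n m : ℕ} (d : Fin (n + 1) → ℂ) (C : Matrix (Fin m) (Fin (n + 1)) ℂ)
    (hunst : 1 < ‖d 0‖)
    (Q : Matrix (Fin (n + 1)) (Fin (n + 1)) ℂ) (R : Matrix (Fin m) (Fin m) ℂ)
    (hQ : Q.PosDef) (hR : R.PosDef)
    {Ω : Type} [MeasurableSpace Ω] (μ : Measure Ω) [IsProbabilityMeasure μ]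
    (γ : ℕ → Ω → ℝ) (p : ℝ)
    (hmeas : ∀ k, Measurable (γ k))
    (hind : iIndepFun γ μ)
    (h01 : ∀ k ω, γ k ω = 0 ∨ γ k ω = 1)
    (hber : ∀ k, μ {ω | γ k ω = 1} = ENNReal.ofReal p)
    (hp : p < 1 - (‖d 0‖ ^ 2)⁻¹) :
    ¬ EBounded μ (fun k ω => ricc (Matrix.diagonal d) C Q R 1 (fun i => γ i ω) k) := by
  rintro ⟨hint, M, hM, hle⟩
  set ρ2 := ‖d 0‖ ^ 2 with hρ2
  have hρ1 : 1 < ρ2 := by rw [hρ2]; nlinarith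
  have hi1 := inv_lt_one_of_one_lt₀ hρ1
  set a := 1 - max p 0 with ha
  have haρ : ρ2⁻¹ < a := by
    have : max p 0 < 1 - ρ2⁻¹ := max_lt hp (by linarith)
    linarith
  have ha1 : 1 < ρ2 * a := by
    have := mul_lt_mul_of_pos_left haρ (show 0 < ρ2 by linarith)
    rwa [mul_inv_cancel₀ (by linarith)] at this
  have h0 : ∀ l, μ.real (γ l ⁻¹' {0}) = a := fun l => by
    have e : γ l ⁻¹' {0} = {ω | γ l ω = 1}ᶜ := by
      ext ω
      simp only [Set.mem_preimage, Set.mem_singleton_iff, Set.mem_compl_iff, Set.mem_ofPred_eq]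
      rcases h01 l ω with h | h <;> simp [h]
    have hm1 : MeasurableSet {ω | γ l ω = 1} := hmeas l (measurableSet_singleton 1)
    rw [e, probReal_compl_eq_one_sub hm1, Measure.real, hber l,
      ENNReal.toReal_ofReal']
  have key : ∀ k, (ρ2 * a) ^ k ≤ (M 0 0).re := fun k => by
    set E := ⋂ i ∈ Finset.range k, γ i ⁻¹' {0} with hE
    have hEm : MeasurableSet E :=
      Finset.measurableSet_biInter _ fun i _ => hmeas i (measurableSet_singleton 0)
    have hμE : μ.real E = a ^ k := by
      rw [Measure.real, hE, hind.measure_inter_preimage_eq_mul (Finset.range k)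
        (fun i _ => measurableSet_singleton 0), ENNReal.toReal_prod]
      have : ∀ i ∈ Finset.range k, (μ (γ i ⁻¹' {0})).toReal = a := fun i _ => h0 i
      rw [Finset.prod_congr rfl this]
      simp
    have h1 : 0 ≤ ((M - matExp μ
      (fun ω => ricc (Matrix.diagonal d) C Q R 1 (fun i => γ i ω) k)) 0 0).re :=
      (Complex.le_def.1 (hle k).diag_nonneg).1
    rw [Matrix.sub_apply, Complex.sub_re] at h1
    have h2 : (matExp μ (fun ω => ricc (Matrix.diagonal d) C Q R 1 (fun i => γ i ω) k) 0 0).re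
        = ∫ ω, (ricc (Matrix.diagonal d) C Q R 1 (fun i => γ i ω) k 0 0).re ∂μ :=
      (integral_re (hint k 0 0)).symm
    have h3 : ∫ ω, E.indicator (fun _ => ρ2 ^ k) ω ∂μ ≤
        ∫ ω, (ricc (Matrix.diagonal d) C Q R 1 (fun i => γ i ω) k 0 0).re ∂μ := by
      refine integral_mono ((integrable_const _).indicator hEm) (hint k 0 0).re fun ω => ?_
      by_cases hω : ω ∈ E
      · rw [Set.indicator_of_mem hω]
        refine ricc_entry_ge d C Q R hQ _ k fun i hi => ?_
        have := Set.mem_iInter₂.1 hω i (Finset.mem_range.2 hi)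
        simpa using this
      · rw [Set.indicator_of_notMem hω]
        exact (Complex.le_def.1 (ricc_psd (Matrix.diagonal d) C hQ hR Matrix.PosSemidef.one _
          (fun k => h01 k ω) k).diag_nonneg).1
    rw [integral_indicator_const _ hEm, hμE, smul_eq_mul] at h3
    rw [mul_pow]
    linarith
  obtain ⟨k, hk⟩ := pow_unbounded_of_one_lt (M 0 0).re ha1
  exact absurd (key k) (not_le.2 hk)

end Final


/-- for a detectable diagonalizable system whose unstable and critically stable
equi-blocks are non-degenerate, the critical value is `p_c = 1 − |λ₁|⁻²`: above it the expected
error covariance is bounded for every PSD initial condition; below it, unbounded for some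
initial condition. -/
theorem stmt4 {n m : ℕ} (d : Fin (n + 1) → ℂ) (C : Matrix (Fin m) (Fin (n + 1)) ℂ)
    (hsort : ∀ i j : Fin (n + 1), i ≤ j → ‖d j‖ ≤ ‖d i‖)
    (hunst : 1 < ‖d 0‖)
    (hdet : Detectable (Matrix.diagonal d) C)
    (hnd : ∀ r : ℝ, 1 ≤ r → LinearIndependent ℂ
      (fun j : {j : Fin (n + 1) // ‖d j‖ = r} => fun i : Fin m => C i j.1))
    (Q : Matrix (Fin (n + 1)) (Fin (n + 1)) ℂ) (R : Matrix (Fin m) (Fin m) ℂ)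
    (hQ : Q.PosDef) (hR : R.PosDef)
    {Ω : Type} [MeasurableSpace Ω] (μ : Measure Ω) [IsProbabilityMeasure μ]
    (γ : ℕ → Ω → ℝ) (p : ℝ)
    (hmeas : ∀ k, Measurable (γ k))
    (hind : iIndepFun γ μ)
    (h01 : ∀ k ω, γ k ω = 0 ∨ γ k ω = 1)
    (hber : ∀ k, μ {ω | γ k ω = 1} = ENNReal.ofReal p) :
    (1 - (‖d 0‖ ^ 2)⁻¹ < p →
      ∀ S0 : Matrix (Fin (n + 1)) (Fin (n + 1)) ℂ, S0.PosSemidef →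
        EBounded μ (fun k ω => ricc (Matrix.diagonal d) C Q R S0 (fun i => γ i ω) k)) ∧
    (p < 1 - (‖d 0‖ ^ 2)⁻¹ →
      ∃ S0 : Matrix (Fin (n + 1)) (Fin (n + 1)) ℂ, S0.PosSemidef ∧
        ¬ EBounded μ (fun k ω => ricc (Matrix.diagonal d) C Q R S0 (fun i => γ i ω) k)) := by
  have hmax : ∀ j, ‖d j‖ ≤ ‖d 0‖ := fun j => hsort 0 j (Fin.zero_le j)
  exact ⟨fun hp S0 hS => upper_bound d C hmax hunst hnd Q R hQ hR μ γ p hmeas hind h01 hber hp S0 hS,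
    fun hp => ⟨1, Matrix.PosSemidef.one,
      lower_bound d C hunst Q R hQ hR μ γ p hmeas hind h01 hber hp⟩⟩
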